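/- Let R be a finite local ring with identity, with |R| = q^n for some integer n ≥ 2, whose residue field R/J has q elements, where J = J(R) is the Jacobson radical. Then P_x(R) = ((q − 1)(q^{n−2} + 1))/q^{2n−1} for every nonzero x ∈ J if and only if |R| = q² (that is, n = 2). -/

import Mathlib

/-- The multiplication probability of a finite ring `R` at `x`:
`P_x(R) = |{(a,b) ∈ R × R : a*b = x}| / |R|²`. -/
noncomputable def mulProb (R : Type*) [Ring R] (x : R) : ℚ :=
  (Nat.card {p : R × R // p.1 * p.2 = x} : ℚ) / (Nat.card R : ℚ) ^ 2

/-- The Jacobson radical of a ring, as a two-sided ideal. -/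
abbrev jacobsonRadical (R : Type*) [Ring R] : TwoSidedIdeal R :=
  (⊥ : TwoSidedIdeal R).jacobson

/-- The residue ring `R/J(R)` of a ring modulo its Jacobson radical. -/
abbrev residueRing (R : Type*) [Ring R] : Type _ :=
  (jacobsonRadical R).ringCon.Quotient

theorem mpAux_mem {R : Type*} [Ring R] [Finite R] [IsLocalRing R] (x : R) :
    x ∈ jacobsonRadical R ↔ ¬ IsUnit x := by
  rw [TwoSidedIdeal.mem_jacobson_iff]
  constructor
  · rintro h ⟨u, rfl⟩
    obtain ⟨z, hz⟩ := h (-(↑u⁻¹ : R))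
    simp [mul_assoc, TwoSidedIdeal.mem_bot] at hz
  · intro hx y
    have h1 : ¬ IsUnit (-(y * x)) := by
      intro h
      rw [IsUnit.neg_iff] at h
      obtain ⟨u, hu⟩ := h
      apply hx
      have : (↑u⁻¹ * y) * x = 1 := by rw [mul_assoc, ← hu]; simp
      exact ⟨⟨x, _, mul_eq_one_symm this, this⟩, rfl⟩
    obtain ⟨u, hu⟩ := (IsLocalRing.isUnit_or_isUnit_of_add_one
      (show -(y * x) + (1 - -(y * x)) = 1 by abel)).resolve_left h1
    refine ⟨↑u⁻¹, ?_⟩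
    have h2 : (↑u⁻¹ : R) * (1 + y * x) = 1 := by
      have : 1 + y * x = (u : R) := by rw [hu]; abel
      rw [this]; simp
    have h3 : (↑u⁻¹ : R) * y * x + ↑u⁻¹ - 1 = 0 := by
      rw [← h2]; noncomm_ring
    rw [h3]; exact TwoSidedIdeal.zero_mem _

def mpAux_map {R : Type*} [Ring R] (x : R) : Rˣ ⊕ Rˣ → {p : R × R // p.1 * p.2 = x}
  | .inl u => ⟨(u, ↑u⁻¹ * x), by simp⟩
  | .inr u => ⟨(x * ↑u⁻¹, u), by simp⟩

theorem mpAux_inj {R : Type*} [Ring R] (x : R) (hx : ¬ IsUnit x) :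
    Function.Injective (mpAux_map x) := by
  rintro (u | u) (v | v) h <;> simp only [mpAux_map, Subtype.mk.injEq, Prod.mk.injEq] at h
  · rw [Units.ext h.1]
  · exact absurd ((Units.isUnit_units_mul _ _).mp (h.2 ▸ v.isUnit)) hx
  · exact absurd ((Units.isUnit_units_mul _ _).mp (h.2 ▸ u.isUnit)) hx
  · rw [Units.ext h.2]

theorem mpAux_surj {R : Type*} [Ring R] (x : R)
    (h : ∀ a b : R, ¬ IsUnit a → ¬ IsUnit b → a * b ≠ x) :
    Function.Surjective (mpAux_map x) := by
  rintro ⟨⟨a, b⟩, hab⟩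
  by_cases ha : IsUnit a
  · obtain ⟨u, rfl⟩ := ha
    refine ⟨.inl u, ?_⟩
    simp only at hab
    simp [mpAux_map, ← hab]
  by_cases hb : IsUnit b
  · obtain ⟨u, rfl⟩ := hb
    refine ⟨.inr u, ?_⟩
    simp only at hab
    simp [mpAux_map, ← hab]
  exact absurd hab (h a b ha hb)

/-- The radical as an additive subgroup. -/
def mpAux_J (R : Type*) [Ring R] : AddSubgroup R :=
  (TwoSidedIdeal.asIdeal (jacobsonRadical R)).toAddSubgroup

theorem mpAux_mem_J {R : Type*} [Ring R] [Finite R] [IsLocalRing R] (x : R) :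
    x ∈ mpAux_J R ↔ ¬ IsUnit x := by
  rw [← mpAux_mem, ← TwoSidedIdeal.mem_asIdeal]; rfl

theorem mpAux_card {R : Type*} [Ring R] :
    Nat.card R = Nat.card (residueRing R) * Nat.card (mpAux_J R) := by
  rw [AddSubgroup.card_eq_card_quotient_mul_card_addSubgroup (mpAux_J R)]
  congr 1
  refine Nat.card_congr (Quotient.congr (Equiv.refl R) ?_)
  intro a b
  rw [QuotientAddGroup.leftRel_apply]
  change _ ↔ (jacobsonRadical R).ringCon a b
  rw [TwoSidedIdeal.rel_iff, ← TwoSidedIdeal.mem_asIdeal, ← neg_mem_iff, neg_add_rev, neg_neg,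
    add_comm, add_comm, neg_add_eq_sub]
  rfl

theorem mpAux_units {R : Type*} [Ring R] [Finite R] [IsLocalRing R] :
    Nat.card Rˣ + Nat.card (mpAux_J R) = Nat.card R := by
  classical
  have e : Rˣ ≃ {x : R // IsUnit x} :=
    Equiv.ofBijective (fun u => ⟨u, u.isUnit⟩)
      ⟨fun u v h => Units.ext (congrArg Subtype.val h), fun ⟨x, u, hu⟩ => ⟨u, Subtype.ext hu⟩⟩
  have e2 : mpAux_J R ≃ {x : R // ¬ IsUnit x} := Equiv.subtypeEquivRight mpAux_mem_J
  rw [Nat.card_congr e, Nat.card_congr e2, ← Nat.card_sum]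
  exact Nat.card_congr (Equiv.sumCompl _)

theorem mpAux_sq {R : Type*} [Ring R] [Finite R] [IsLocalRing R] {q : ℕ} (hq : 0 < q)
    (hJ : Nat.card (mpAux_J R) = q) (hR : Nat.card R = q ^ 2) (a b : R)
    (ha : ¬ IsUnit a) (hb : ¬ IsUnit b) : a * b = 0 := by
  by_cases ha0 : a = 0
  · simp [ha0]
  let f := AddMonoidHom.mulLeft a
  have hk : f.ker ≤ mpAux_J R := by
    intro y hy
    rw [mpAux_mem_J]
    intro hu
    have : a * y = 0 := hy
    exact ha0 ((IsUnit.mul_left_eq_zero hu).mp this)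
  have hr : f.range ≤ mpAux_J R := by
    rintro _ ⟨y, rfl⟩
    have : a ∈ jacobsonRadical R := (mpAux_mem a).2 ha
    rw [mpAux_mem_J, ← mpAux_mem]
    exact TwoSidedIdeal.mul_mem_right _ _ _ this
  have h1 := AddSubgroup.card_le_of_le hr
  have h2 := f.ker.card_mul_index
  rw [AddSubgroup.index_ker, hR] at h2
  rw [hJ] at h1
  have h3 : q ≤ Nat.card f.ker := by
    by_contra h
    push Not at h
    nlinarith
  have h4 : f.ker = mpAux_J R := by
    apply SetLike.coe_injective
    refine Set.eq_of_subset_of_ncard_le hk ?_ (Set.toFinite _)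
    change Nat.card (mpAux_J R) ≤ Nat.card f.ker
    rw [hJ]; exact h3
  have : b ∈ f.ker := h4 ▸ (mpAux_mem_J b).2 hb
  exact this

/-- Let `R` be a finite local ring with `|R| = qⁿ`, `n ≥ 2`, whose residue
field `R/J` has `q` elements. Then `P_x(R) = (q − 1)(q^{n−2} + 1)/q^{2n−1}` for every nonzero
`x ∈ J` if and only if `|R| = q²`. -/
theorem mulProb_lower_eq_iff_card_eq_sq
    {R : Type*} [Ring R] [Finite R] [IsLocalRing R] {q n : ℕ} (hn : 2 ≤ n)
    (hcard : Nat.card R = q ^ n) (hres : Nat.card (residueRing R) = q) :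
    (∀ x ∈ jacobsonRadical R, x ≠ 0 →
        mulProb R x = ((q : ℚ) - 1) * ((q : ℚ) ^ (n - 2) + 1) / (q : ℚ) ^ (2 * n - 1)) ↔
      Nat.card R = q ^ 2 := by
  obtain ⟨m, rfl⟩ : ∃ m, n = m + 2 := ⟨n - 2, by omega⟩
  have hc := mpAux_card (R := R)
  have hu := mpAux_units (R := R)
  rw [hres] at hc
  have h1R : 1 < Nat.card R := Finite.one_lt_card
  have hq1 : 1 < q := by
    rcases q with _ | _ | q
    · simp at hcard; omega
    · simp at hcard; omega
    · omega
  have hJ : Nat.card (mpAux_J R) = q ^ (m + 1) := by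
    have : q * Nat.card (mpAux_J R) = q * q ^ (m + 1) := by rw [← hc, hcard]; ring
    exact Nat.eq_of_mul_eq_mul_left (by omega) this
  have hqQ : (1 : ℚ) < q := by exact_mod_cast hq1
  have hU : (Nat.card Rˣ : ℚ) = q ^ (m + 1) * (q - 1) := by
    have : (Nat.card Rˣ : ℚ) + (q : ℚ) ^ (m + 1) = (q : ℚ) ^ (m + 2) := by
      rw [hJ, hcard] at hu; exact_mod_cast hu
    linear_combination this
  have key : ∀ x : R, (mulProb R x = ((q : ℚ) - 1) * ((q : ℚ) ^ (m + 2 - 2) + 1) /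
      (q : ℚ) ^ (2 * (m + 2) - 1) ↔
      (Nat.card {p : R × R // p.1 * p.2 = x} : ℚ) = (q - 1) * (q ^ m + 1) * q) := by
    intro x
    have e1 : 2 * (m + 2) - 1 = 2 * m + 3 := by omega
    have hq0 : (q : ℚ) ≠ 0 := by positivity
    rw [mulProb, hcard, e1, Nat.add_sub_cancel]
    push_cast
    rw [div_eq_div_iff (by positivity) (by positivity)]
    constructor
    · intro h
      have hp : (q : ℚ) ^ (2 * m + 3) ≠ 0 := by positivity
      apply mul_right_cancel₀ hp
      rw [h]; ring
    · intro h
      rw [h]; ring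
  constructor
  · intro H
    rcases Nat.eq_zero_or_pos m with rfl | hm
    · simpa using hcard
    exfalso
    have : Nontrivial (mpAux_J R) := by
      rw [← Finite.one_lt_card_iff_nontrivial, hJ]
      exact Nat.one_lt_pow (by omega) hq1
    obtain ⟨⟨x, hx⟩, hx0⟩ := exists_ne (0 : mpAux_J R)
    have hx0 : x ≠ 0 := fun h => hx0 (Subtype.ext h)
    rw [mpAux_mem_J] at hx
    have h := (key x).1 (H x ((mpAux_mem x).2 hx) hx0)
    have hle := Nat.card_le_card_of_injective _ (mpAux_inj x hx)
    rw [Nat.card_sum] at hle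
    have hle' : (Nat.card Rˣ : ℚ) + Nat.card Rˣ ≤ Nat.card {p : R × R // p.1 * p.2 = x} := by
      exact_mod_cast hle
    rw [h, hU] at hle'
    have hp : (1 : ℚ) < (q : ℚ) ^ m := one_lt_pow₀ hqQ (by omega)
    have : 0 < ((q : ℚ) - 1) * q * (q ^ m - 1) := by
      apply mul_pos (mul_pos _ _) <;> linarith
    rw [pow_succ] at hle'
    nlinarith
  · intro h2 x hx hx0
    have hm : m = 0 := by
      have := Nat.pow_right_injective hq1 (hcard.symm.trans h2)
      omega
    subst hm
    rw [key]
    rw [mpAux_mem] at hx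
    have hs := mpAux_sq (q := q) (by omega) (by simpa using hJ) h2
    have hb : Function.Bijective (mpAux_map x) :=
      ⟨mpAux_inj x hx, mpAux_surj x fun a b ha hb h => hx0 (by rw [← h, hs a b ha hb])⟩
    rw [← Nat.card_eq_of_bijective _ hb, Nat.card_sum]
    push_cast
    rw [hU]; ring
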